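/- Let E, F be field extensions of a field K with F pseudo-algebraically closed (PAC) and E/K separable, viewed as structures in the language of rings with constants from K. If every existential sentence with at most one quantifier true in E is true in F (Th_{∃₁}(E) ⊆ Th_{∃₁}(F)), then every existential sentence true in E is true in F (Th_∃(E) ⊆ Th_∃(F)). -/

import Mathlib

open FirstOrder Set FirstOrder.Ring

universe u v w

namespace PaperStmt

/-- Existential formulas (free variables in `α`) with at most `n` quantifiers. -/
def existentialFormulasUpTo (L : FirstOrder.Language.{u, v}) (α : Type w) (n : ℕ) :
    Set (L.Formula α) :=
  {φ | ∃ m, m ≤ n ∧ ∃ ψ : L.BoundedFormula α m, ψ.IsQF ∧ φ = ψ.exs}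

/-- Existential formulas (free variables in `α`). -/
def existentialFormulas (L : FirstOrder.Language.{u, v}) (α : Type w) : Set (L.Formula α) :=
  {φ | ∃ m, ∃ ψ : L.BoundedFormula α m, ψ.IsQF ∧ φ = ψ.exs}

/-- The smallest set of formulas containing `⊤`, `⊥` and a given set `S`, closed under
`∧` and `∨` (the fragment generated by `S`). -/
def formulaFragmentClosure {L : FirstOrder.Language.{u, v}} {α : Type w}
    (S : Set (L.Formula α)) : Set (L.Formula α) :=
  ⋂₀ {F : Set (L.Formula α) | (⊤ : L.Formula α) ∈ F ∧ (⊥ : L.Formula α) ∈ F ∧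
      (∀ φ ψ : L.Formula α, φ ∈ F → ψ ∈ F → (φ ⊓ ψ) ∈ F ∧ (φ ⊔ ψ) ∈ F) ∧ S ⊆ F}

/-- A field `F` is pseudo-algebraically closed (PAC) if every absolutely irreducible
affine variety over `F` (i.e. one whose defining prime ideal stays prime over the
algebraic closure) has an `F`-rational point. -/
def IsPAC (F : Type u) [Field F] : Prop :=
  ∀ (n : ℕ) (P : Ideal (MvPolynomial (Fin n) F)), P.IsPrime →
    (P.map (MvPolynomial.map (algebraMap F (AlgebraicClosure F))) :
        Ideal (MvPolynomial (Fin n) (AlgebraicClosure F))).IsPrime →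
    ∃ x : Fin n → F, ∀ f ∈ P, MvPolynomial.eval x f = 0

/-- A (possibly transcendental) field extension `E/K` is separable iff `E ⊗_K L` is
reduced for every field extension `L/K` (MacLane's criterion). -/
def IsSeparableFieldExtension (K : Type u) (E : Type v) [Field K] [Field E]
    [Algebra K E] : Prop :=
  ∀ (L : Type u) [Field L] [Algebra K L], IsReduced (TensorProduct K E L)

end PaperStmt

section

open TensorProduct Polynomial

variable {k : Type*} [Field k]

theorem isDomain_tensorProduct_of_forall_fg {B C : Type*} [CommRing B] [Algebra k B]
    [CommRing C] [Algebra k C] [Nontrivial (B ⊗[k] C)]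
    (h : ∀ A : Subalgebra k C, A.FG → IsDomain (B ⊗[k] A)) : IsDomain (B ⊗[k] C) := by
  refine @NoZeroDivisors.to_isDomain _ _ _ ⟨fun {x y} hxy ↦ ?_⟩
  obtain ⟨A₁, hA₁, hx⟩ := exists_fg_and_mem_baseChange x
  obtain ⟨A₂, hA₂, hy⟩ := exists_fg_and_mem_baseChange y
  have := h _ (hA₁.sup hA₂)
  have hmono {A A' : Subalgebra k C} (hle : A ≤ A') : A.baseChange B ≤ A'.baseChange B := by
    rintro _ ⟨z, rfl⟩
    refine ⟨Algebra.TensorProduct.map (.id B B) (Subalgebra.inclusion hle) z, ?_⟩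
    induction z with
    | zero => simp
    | add a b ha hb => simp_all
    | tmul a b => simp
  obtain ⟨x, rfl⟩ := hmono (le_sup_left : A₁ ≤ A₁ ⊔ A₂) hx
  obtain ⟨y, rfl⟩ := hmono (le_sup_right : A₂ ≤ A₁ ⊔ A₂) hy
  have hinj : Function.Injective
      (Algebra.TensorProduct.map (AlgHom.id B B) (A₁ ⊔ A₂).val) :=
    Module.Flat.lTensor_preserves_injective_linearMap (M := B) (A₁ ⊔ A₂).val.toLinearMap
      Subtype.val_injective
  have h0 : x * y = 0 := hinj (by rw [map_mul, map_zero]; exact hxy)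
  rcases mul_eq_zero.mp h0 with rfl | rfl
  · exact .inl (map_zero _)
  · exact .inr (map_zero _)

theorem Polynomial.Monic.irreducible_map_of_forall_isIntegral {E : Type*} [Field E] [Algebra k E]
    (hk : ∀ x : E, IsIntegral k x → x ∈ (algebraMap k E).range) {f : k[X]} (hm : f.Monic)
    (hf : Irreducible f) : Irreducible (f.map (algebraMap k E)) := by
  have hlift (g : E[X]) (hg : g.Monic) (hd : g ∣ f.map (algebraMap k E)) :
      ∃ g' : k[X], g'.map (algebraMap k E) = g := by
    have := integralClosure.mem_lifts_of_monic_of_dvd_map E hm hg hd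
    rw [lifts_iff_coeff_lifts] at this
    refine (mem_lifts g).mp ((lifts_iff_coeff_lifts g).mpr fun n ↦ ?_)
    obtain ⟨⟨y, hy⟩, hy'⟩ := this n
    rw [← hy']
    exact hk y hy
  refine ((hm.map _).irreducible_iff_natDegree).mpr ⟨?_, fun g h hg hh hgh ↦ ?_⟩
  · intro h1
    exact hf.ne_one (map_injective _ (algebraMap k E).injective (h1.trans (by simp)))
  · obtain ⟨g', rfl⟩ := hlift g hg (Dvd.intro _ hgh)
    obtain ⟨h', rfl⟩ := hlift h hh (Dvd.intro_left _ hgh)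
    rw [← Polynomial.map_mul] at hgh
    have hgh := map_injective _ (algebraMap k E).injective hgh
    replace hg := monic_of_injective (algebraMap k E).injective hg
    replace hh := monic_of_injective (algebraMap k E).injective hh
    rw [hg.natDegree_map, hh.natDegree_map]
    exact (hm.irreducible_iff_natDegree.mp hf).2 g' h' hg hh hgh

/-- Base change of `k[X]/(f)` to a `k`-algebra `T` is `T[X]/(f)`. -/
noncomputable def AdjoinRoot.tensorEquivMap {k : Type*} [CommRing k] (T : Type*) [CommRing T]
    [Algebra k T] (f : k[X]) :
    T ⊗[k] AdjoinRoot f ≃+* AdjoinRoot (f.map (algebraMap k T)) :=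
  (AdjoinRoot.tensorAlgEquiv (R := k) (T := T) f
    (f.map (Algebra.TensorProduct.includeRight : k →ₐ[k] T ⊗[k] k).toRingHom)
    rfl).toRingEquiv.trans
  (Ideal.quotientEquiv _ _ (mapEquiv (Algebra.TensorProduct.rid k k T).toRingEquiv) (by
    rw [Ideal.map_span, Set.image_singleton]
    congr 2
    simp only [RingEquiv.coe_toRingHom, mapEquiv_apply, Polynomial.map_map]
    congr 1
    ext
    simp [Algebra.algebraMap_eq_smul_one]))

theorem isDomain_tensorProduct_of_isSeparable {E C : Type*} [Field E] [Algebra k E]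
    [Field C] [Algebra k C] [Algebra.IsSeparable k C]
    (hk : ∀ x : E, IsIntegral k x → x ∈ (algebraMap k E).range) : IsDomain (E ⊗[k] C) := by
  refine isDomain_tensorProduct_of_forall_fg fun A hA ↦ ?_
  let _ : Field A := (Subalgebra.isField_of_algebraic A).toField
  have : Algebra.IsSeparable k A := Algebra.isSeparable_tower_bot_of_isSeparable k A C
  have : Module.Finite k A := Algebra.IsIntegral.finite (h' := A.fg_iff_finiteType.mp hA)
  obtain ⟨α, hα⟩ := Field.exists_primitive_element k A
  have hα_int := Algebra.IsIntegral.isIntegral (R := k) α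
  have hirr := (minpoly.monic hα_int).irreducible_map_of_forall_isIntegral hk
    (minpoly.irreducible hα_int)
  have : Fact (Irreducible ((minpoly k α).map (algebraMap k E))) := ⟨hirr⟩
  let e₁ : A ≃ₐ[k] AdjoinRoot (minpoly k α) :=
    (IntermediateField.topEquiv.symm.trans (IntermediateField.equivOfEq hα.symm)).trans
      (IntermediateField.adjoinRootEquivAdjoin k hα_int).symm
  let e : E ⊗[k] A ≃ₐ[k] E ⊗[k] AdjoinRoot (minpoly k α) :=
    Algebra.TensorProduct.congr AlgEquiv.refl e₁
  exact (e.toRingEquiv.trans (AdjoinRoot.tensorEquivMap E (minpoly k α))).toMulEquiv.isDomain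

theorem isDomain_tensorProduct_of_isPurelyInseparable (S : Type*) {B C : Type*} [Field S]
    [Algebra k S] [Field C] [Algebra k C] [Algebra S C] [IsScalarTower k S C]
    [IsPurelyInseparable S C] [CommRing B] [Algebra k B] [IsDomain (S ⊗[k] B)]
    [IsReduced (C ⊗[k] B)] : IsDomain (C ⊗[k] B) := by
  let e : C ⊗[k] B ≃+* (S ⊗[k] B) ⊗[S] C :=
    (Algebra.TensorProduct.cancelBaseChange k S C C B).symm.toRingEquiv.trans
      (Algebra.TensorProduct.comm S C (S ⊗[k] B)).toRingEquiv
  have hred : IsReduced ((S ⊗[k] B) ⊗[S] C) := isReduced_of_injective e.symm e.symm.injective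
  have hinj : Function.Injective (algebraMap (S ⊗[k] B) ((S ⊗[k] B) ⊗[S] C)) :=
    Algebra.TensorProduct.includeLeft_injective (S := S) (algebraMap S C).injective
  suffices IsDomain ((S ⊗[k] B) ⊗[S] C) from e.toMulEquiv.isDomain
  have := hinj.nontrivial
  refine @NoZeroDivisors.to_isDomain _ _ _ ⟨fun {x y} hxy ↦ ?_⟩
  obtain ⟨n, hn, a, ha⟩ := IsPurelyInseparable.exists_pow_mem_range_tensorProduct x
  obtain ⟨m, hm, b, hb⟩ := IsPurelyInseparable.exists_pow_mem_range_tensorProduct y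
  have h0 : a ^ m * b ^ n = 0 := hinj (by
    rw [map_mul, map_pow, map_pow, ha, hb, ← pow_mul, ← pow_mul, mul_comm m n, ← mul_pow, hxy,
      zero_pow (by positivity), map_zero])
  rcases mul_eq_zero.mp h0 with h | h
  · left
    rw [eq_zero_of_pow_eq_zero h, map_zero] at ha
    exact eq_zero_of_pow_eq_zero ha.symm
  · right
    rw [eq_zero_of_pow_eq_zero h, map_zero] at hb
    exact eq_zero_of_pow_eq_zero hb.symm

theorem isDomain_tensorProduct_of_isAlgebraic {E C : Type*} [Field E] [Algebra k E]
    [Field C] [Algebra k C] [Algebra.IsAlgebraic k C] [IsReduced (C ⊗[k] E)]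
    (hk : ∀ x : E, IsIntegral k x → x ∈ (algebraMap k E).range) : IsDomain (C ⊗[k] E) := by
  have : IsDomain (E ⊗[k] separableClosure k C) := isDomain_tensorProduct_of_isSeparable hk
  have : IsDomain (separableClosure k C ⊗[k] E) :=
    (Algebra.TensorProduct.comm k (separableClosure k C) E).toMulEquiv.isDomain
  exact isDomain_tensorProduct_of_isPurelyInseparable (separableClosure k C)

theorem exists_algHom_apply_ne_zero [IsAlgClosed k] {A : Type*} [CommRing A] [IsDomain A]
    [Algebra k A] [Algebra.FiniteType k A] {a : A} (ha : a ≠ 0) :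
    ∃ φ : A →ₐ[k] k, φ a ≠ 0 := by
  let A' := Localization.Away a
  have : Algebra.FiniteType k A' :=
    Algebra.FiniteType.trans (S := A) inferInstance
      (inferInstanceAs (Algebra.FiniteType A (Localization.Away a)))
  have : Nontrivial A' :=
    (IsLocalization.injective A' (powers_le_nonZeroDivisors_of_noZeroDivisors ha)).nontrivial
  obtain ⟨m, hm⟩ := Ideal.exists_maximal A'
  let _ : Field (A' ⧸ m) := Ideal.Quotient.field m
  have : Algebra.FiniteType k (A' ⧸ m) := inferInstance
  have : Module.Finite k (A' ⧸ m) := finite_of_finite_type_of_isJacobsonRing k (A' ⧸ m)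
  let e : k ≃ₐ[k] A' ⧸ m := AlgEquiv.ofBijective (Algebra.ofId k _)
    IsAlgClosed.algebraMap_bijective_of_isIntegral
  let ψ : A' →ₐ[k] k := e.symm.toAlgHom.comp (Ideal.Quotient.mkₐ k m)
  refine ⟨ψ.comp (IsScalarTower.toAlgHom k A A'), ?_⟩
  exact ((IsLocalization.Away.algebraMap_isUnit (S := A') a).map ψ).ne_zero

theorem isDomain_tensorProduct_of_isAlgClosed [IsAlgClosed k] {A B : Type*}
    [CommRing A] [IsDomain A] [Algebra k A] [CommRing B] [IsDomain B] [Algebra k B] :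
    IsDomain (B ⊗[k] A) := by
  refine isDomain_tensorProduct_of_forall_fg fun A' hA' ↦ ?_
  have : Algebra.FiniteType k A' := A'.fg_iff_finiteType.mp hA'
  suffices IsDomain (A' ⊗[k] B) from (Algebra.TensorProduct.comm k B A').toMulEquiv.isDomain
  refine @NoZeroDivisors.to_isDomain _ _ _ ⟨fun {x y} hxy ↦ ?_⟩
  by_contra! hne
  let b := (Module.Free.chooseBasis k B).baseChange A'
  have hcoord (z : A' ⊗[k] B) (hz : z ≠ 0) : ∃ i, b.repr z i ≠ 0 := by
    by_contra! h
    exact hz (b.repr.map_eq_zero_iff.mp (Finsupp.ext h))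
  obtain ⟨i, hi⟩ := hcoord x hne.1
  obtain ⟨j, hj⟩ := hcoord y hne.2
  obtain ⟨φ, hφ⟩ := exists_algHom_apply_ne_zero (k := k) (mul_ne_zero hi hj)
  rw [map_mul] at hφ
  let Φ : A' ⊗[k] B →ₐ[k] B := Algebra.TensorProduct.lift ((Algebra.ofId k B).comp φ) (.id k B)
    fun _ _ ↦ .all _ _
  have hΦ (z : A' ⊗[k] B) (i) : (Module.Free.chooseBasis k B).repr (Φ z) i = φ (b.repr z i) := by
    induction z with
    | zero => simp
    | add u v hu hv => simp [hu, hv]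
    | tmul u v =>
      have : Φ (u ⊗ₜ v) = φ u • v := by simp [Φ, Algebra.ofId_apply, Algebra.smul_def]
      rw [this]
      simp [b, mul_comm]
  have h0 : Φ x * Φ y = 0 := by rw [← map_mul, hxy, map_zero]
  rcases mul_eq_zero.mp h0 with h | h
  · apply left_ne_zero_of_mul hφ
    rw [← hΦ, h]; simp
  · apply right_ne_zero_of_mul hφ
    rw [← hΦ, h]; simp

theorem isDomain_tensorProduct_of_isDomain (C : Type*) {B Ω : Type*} [Field C] [IsAlgClosed C]
    [Algebra k C] [CommRing B] [Algebra k B] [Field Ω] [Algebra k Ω] [Algebra C Ω]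
    [IsScalarTower k C Ω] [IsDomain (C ⊗[k] B)] : IsDomain (Ω ⊗[k] B) := by
  have : IsDomain (Ω ⊗[C] (C ⊗[k] B)) := isDomain_tensorProduct_of_isAlgClosed
  exact (Algebra.TensorProduct.cancelBaseChange k C Ω Ω B).symm.toMulEquiv.isDomain

theorem isDomain_tensorProduct_of_isReduced {E Ω : Type*} [Field E] [Algebra k E]
    [Field Ω] [IsAlgClosed Ω] [Algebra k Ω] [IsReduced (Ω ⊗[k] E)]
    (hk : ∀ x : E, IsIntegral k x → x ∈ (algebraMap k E).range) : IsDomain (Ω ⊗[k] E) := by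
  let C := algebraicClosure k Ω
  have : IsAlgClosed C := (algebraicClosure.isAlgClosure k Ω).isAlgClosed
  have : IsReduced (C ⊗[k] E) :=
    isReduced_of_injective (Algebra.TensorProduct.map C.val (.id k E))
      (Module.Flat.rTensor_preserves_injective_linearMap C.val.toLinearMap Subtype.val_injective)
  have : IsDomain (C ⊗[k] E) := isDomain_tensorProduct_of_isAlgebraic hk
  exact isDomain_tensorProduct_of_isDomain C

theorem Ideal.IsRadical.sup_span_sub_algebraMap {Ω S : Type*} [Field Ω] [CommRing S] [Algebra Ω S]
    {I : Ideal S} (hI : I.IsRadical) {f : Polynomial Ω} (hf : f.Separable) {b : Ω} (hb : f.IsRoot b)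
    {a : S} (ha : aeval a f ∈ I) : (I ⊔ Ideal.span {a - algebraMap Ω S b}).IsRadical := by
  obtain ⟨g, rfl⟩ := dvd_iff_isRoot.mpr hb
  have hg : g.eval b ≠ 0 := by
    intro h
    have := hf.eval₂_derivative_ne_zero (RingHom.id Ω) (x := b) (by simp)
    simp [h] at this
  set c := a - algebraMap Ω S b with hc
  have hca : c * aeval a g ∈ I := by simpa [hc] using ha
  rw [Ideal.isRadical_iff_pow_one_lt 2 one_lt_two]
  intro s hs
  obtain ⟨i, hi, j, hj, hij⟩ := Submodule.mem_sup.mp hs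
  obtain ⟨t, rfl⟩ := Ideal.mem_span_singleton.mp hj
  have h1 : aeval a g * s ∈ I := by
    refine hI ⟨2, ?_⟩
    have : (aeval a g * s) ^ 2 = aeval a g ^ 2 * i + aeval a g * t * (c * aeval a g) := by
      rw [mul_pow, ← hij]; ring
    rw [this]
    exact I.add_mem (I.mul_mem_left _ hi) (I.mul_mem_left _ hca)
  obtain ⟨u, hu⟩ : c ∣ aeval a g - algebraMap Ω S (g.eval b) := by
    have := Polynomial.sub_dvd_eval_sub a (algebraMap Ω S b) (g.map (algebraMap Ω S))
    simpa [hc, eval_map_algebraMap, aeval_algebraMap_apply] using this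
  have h2 : algebraMap Ω S (g.eval b) * s ∈ I ⊔ Ideal.span {c} := by
    have : algebraMap Ω S (g.eval b) * s = aeval a g * s + (-(u * s)) * c := by
      linear_combination (-s) * hu
    rw [this]
    exact Ideal.add_mem _ (Ideal.mem_sup_left h1)
      (Ideal.mem_sup_right (Ideal.mul_mem_left _ _ (Ideal.mem_span_singleton_self c)))
  exact (Ideal.unit_mul_mem_iff_mem _ (hg.isUnit.map (algebraMap Ω S))).mp h2

theorem Ideal.isRadical_span_range_sub_algebraMap {Ω S ι : Type*} [Field Ω] [CommRing S]
    [IsReduced S] [Algebra Ω S] (f : ι → Polynomial Ω) (hf : ∀ i, (f i).Separable) (b : ι → Ω)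
    (hb : ∀ i, (f i).IsRoot (b i)) (a : ι → S) (ha : ∀ i, aeval (a i) (f i) = 0) :
    (Ideal.span (Set.range fun i ↦ a i - algebraMap Ω S (b i))).IsRadical := by
  classical
  have key (s : Finset ι) : (Ideal.span ((fun i ↦ a i - algebraMap Ω S (b i)) '' s)).IsRadical := by
    induction s using Finset.induction_on with
    | empty => simpa using (Ideal.isRadical_iff_pow_one_lt 2 one_lt_two).mpr (by simp)
    | insert i s _ ih =>
      rw [Finset.coe_insert, Set.image_insert_eq, Ideal.span_insert, sup_comm]
      exact ih.sup_span_sub_algebraMap (hf i) (hb i) (by simp [ha])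
  rw [Ideal.isRadical_iff_pow_one_lt 2 one_lt_two]
  intro s hs
  obtain ⟨T, hT, hsT⟩ := Submodule.mem_span_finite_of_mem_span hs
  obtain ⟨T', hT', rfl⟩ := (Finset.subset_set_image_iff (s := Set.univ)).mp (by simpa using hT)
  exact Ideal.span_mono (by simp) (key T' ⟨2, by simpa using hsT⟩)

theorem isReduced_tensorProduct_of_isSeparable {K k E Ω : Type*} [Field K] [Field k] [Field Ω]
    [CommRing E] [Algebra K k] [Algebra K E] [Algebra K Ω] [Algebra k E] [Algebra k Ω]
    [IsScalarTower K k E] [IsScalarTower K k Ω] [Algebra.IsSeparable K k]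
    [IsReduced (Ω ⊗[K] E)] : IsReduced (Ω ⊗[k] E) := by
  have h := Ideal.isRadical_span_range_sub_algebraMap (Ω := Ω) (S := Ω ⊗[K] E) (ι := k)
    (fun x ↦ (minpoly K x).map (algebraMap K Ω))
    (fun x ↦ Polynomial.Separable.map (Algebra.IsSeparable.isSeparable K x))
    (fun x ↦ algebraMap k Ω x)
    (fun x ↦ by simp [IsRoot, eval_map_algebraMap, aeval_algebraMap_apply])
    (fun x ↦ 1 ⊗ₜ algebraMap k E x) (fun x ↦ by
      rw [aeval_map_algebraMap]
      have := aeval_algHom_apply (Algebra.TensorProduct.includeRight : E →ₐ[K] Ω ⊗[K] E)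
        (algebraMap k E x) (minpoly K x)
      rwa [aeval_algebraMap_apply, minpoly.aeval, map_zero, map_zero] at this)
  rw [← RingHom.ker_isRadical_iff_reduced_of_surjective
    (Algebra.TensorProduct.mapOfCompatibleSMul_surjective k K k Ω E)]
  suffices RingHom.ker (Algebra.TensorProduct.mapOfCompatibleSMul k K k Ω E) =
      Ideal.span (Set.range fun x ↦
        (1 : Ω) ⊗ₜ[K] algebraMap k E x - algebraMap Ω (Ω ⊗[K] E) (algebraMap k Ω x)) by
    rw [this]; exact h
  refine le_antisymm (fun x hx ↦ ?_) (Ideal.span_le.mpr ?_)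
  · replace hx : x ∈ (TensorProduct.mapOfCompatibleSMul k K k Ω E).ker := hx
    rw [TensorProduct.AlgebraTensorModule.ker_mapOfCompatibleSMul] at hx
    induction hx using Submodule.span_induction with
    | mem x hx =>
      obtain ⟨c, m, n, rfl⟩ := hx
      have : (c • m) ⊗ₜ[K] n - m ⊗ₜ[K] (c • n) =
          (-(m ⊗ₜ n)) * (1 ⊗ₜ[K] algebraMap k E c - algebraMap Ω (Ω ⊗[K] E) (algebraMap k Ω c)) := by
        simp [mul_sub, Algebra.smul_def, mul_comm, neg_add_eq_sub]
      rw [this]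
      exact Ideal.mul_mem_left _ _ (Ideal.subset_span ⟨c, rfl⟩)
    | zero => simp
    | add x y _ _ hx hy => exact add_mem hx hy
    | smul c x _ hx =>
      rw [Algebra.smul_def]
      exact Ideal.mul_mem_left _ _ hx
  · rintro _ ⟨c, rfl⟩
    simp [RingHom.mem_ker, Algebra.algebraMap_eq_smul_one,
      Algebra.TensorProduct.one_def]

theorem isSeparable_of_isReduced_tensorProduct (Ω : Type*) {E : Type*} [Field E] [Algebra k E]
    [Field Ω] [PerfectField Ω] [Algebra k Ω] [IsReduced (Ω ⊗[k] E)] {a : E}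
    (ha : IsIntegral k a) : IsSeparable k a := by
  let j : AdjoinRoot (minpoly k a) →ₐ[k] E :=
    (IntermediateField.val _).comp (IntermediateField.adjoinRootEquivAdjoin k ha).toAlgHom
  have hj : Function.Injective j :=
    Subtype.val_injective.comp (IntermediateField.adjoinRootEquivAdjoin k ha).injective
  have : IsReduced (Ω ⊗[k] AdjoinRoot (minpoly k a)) :=
    isReduced_of_injective (Algebra.TensorProduct.map (.id k Ω) j)
      (Module.Flat.lTensor_preserves_injective_linearMap j.toLinearMap hj)
  have : IsReduced (AdjoinRoot ((minpoly k a).map (algebraMap k Ω))) :=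
    isReduced_of_injective (AdjoinRoot.tensorEquivMap Ω (minpoly k a)).symm
      (AdjoinRoot.tensorEquivMap Ω (minpoly k a)).symm.injective
  have hrad := isRadical_iff_span_singleton.mpr ((Ideal.isRadical_iff_quotient_reduced _).mpr this)
  rw [isRadical_iff_squarefree_of_ne_zero
    (Polynomial.map_ne_zero (minpoly.ne_zero ha)), ← PerfectField.separable_iff_squarefree,
    Polynomial.separable_map] at hrad
  exact hrad

open MvPolynomial in
theorem isPrime_map_ker_of_isDomain_tensorProduct {σ B Ω : Type*} [CommRing B] [Algebra k B]
    [Field Ω] [Algebra k Ω] [IsDomain (Ω ⊗[k] B)] (φ : MvPolynomial σ k →ₐ[k] B) :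
    ((RingHom.ker φ).map (MvPolynomial.map (algebraMap k Ω))).IsPrime := by
  have : IsDomain (Ω ⊗[k] φ.range) :=
    Function.Injective.isDomain (Algebra.TensorProduct.map (.id k Ω) φ.range.val).toRingHom
      (Module.Flat.lTensor_preserves_injective_linearMap φ.range.val.toLinearMap
        Subtype.val_injective)
  have h : (RingHom.ker (Algebra.TensorProduct.map (AlgHom.id k Ω) φ.rangeRestrict)).IsPrime :=
    RingHom.ker_isPrime _
  rw [Algebra.TensorProduct.lTensor_ker _ φ.rangeRestrict_surjective] at h
  have hker : RingHom.ker φ.rangeRestrict = RingHom.ker φ := by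
    ext; simp [RingHom.mem_ker, Subtype.ext_iff]
  have hmap : (RingHom.ker φ).map (MvPolynomial.map (algebraMap k Ω)) =
      ((RingHom.ker φ.rangeRestrict).map
        (Algebra.TensorProduct.includeRight : _ →ₐ[k] Ω ⊗[k] MvPolynomial σ k).toRingHom).map
        (algebraTensorAlgEquiv (σ := σ) k Ω).toAlgHom.toRingHom := by
    rw [Ideal.map_map, hker]
    congr 1
    ext x <;> simp
  rw [hmap]
  exact @Ideal.map_isPrime_of_equiv _ _ _ _ _ _ _
    (algebraTensorAlgEquiv (σ := σ) k Ω) _ h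

end

namespace PaperStmt

section

open TensorProduct Polynomial

theorem IsPAC.exists_specialization_of_forall_isIntegral {k : Type*} {E : Type*} {F : Type u}
    [Field k] [Field E] [Field F] [Algebra k E] [Algebra k F]
    [IsReduced (AlgebraicClosure F ⊗[k] E)] (hF : IsPAC F)
    (hk : ∀ x : E, IsIntegral k x → x ∈ (algebraMap k E).range) {n : ℕ} (x : Fin n → E) :
    ∃ y : Fin n → F, ∀ f : MvPolynomial (Fin n) k,
      MvPolynomial.aeval x f = 0 → MvPolynomial.aeval y f = 0 := by
  have : IsDomain (AlgebraicClosure F ⊗[k] E) := isDomain_tensorProduct_of_isReduced hk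
  have : IsDomain (AlgebraicClosure F ⊗[F] (F ⊗[k] E)) :=
    (Algebra.TensorProduct.cancelBaseChange k F F (AlgebraicClosure F) E).toMulEquiv.isDomain
  let ι : F ⊗[k] E →ₐ[F] AlgebraicClosure F ⊗[F] (F ⊗[k] E) := Algebra.TensorProduct.includeRight
  have hι : Function.Injective ι :=
    Algebra.TensorProduct.includeRight_injective (algebraMap F (AlgebraicClosure F)).injective
  have : IsDomain (F ⊗[k] E) := hι.isDomain ι.toRingHom
  let φ : MvPolynomial (Fin n) F →ₐ[F] F ⊗[k] E := MvPolynomial.aeval fun i ↦ 1 ⊗ₜ x i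
  obtain ⟨y, hy⟩ := hF n (RingHom.ker φ) (RingHom.ker_isPrime φ)
    (isPrime_map_ker_of_isDomain_tensorProduct φ)
  refine ⟨y, fun f hf ↦ ?_⟩
  have h := hy (MvPolynomial.map (algebraMap k F) f) (by
    have := MvPolynomial.comp_aeval_apply (f := x)
      (Algebra.TensorProduct.includeRight : E →ₐ[k] F ⊗[k] E) f
    rw [hf, map_zero] at this
    rw [RingHom.mem_ker, MvPolynomial.aeval_map_algebraMap, this]
    rfl)
  rwa [MvPolynomial.eval_map, ← MvPolynomial.aeval_def] at h

theorem IsPAC.exists_specialization {K E F : Type u} [Field K] [Field E] [Field F]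
    [Algebra K E] [Algebra K F] (hF : IsPAC F) (hE : IsSeparableFieldExtension K E)
    (hroot : ∀ f : Polynomial K, (∃ a : E, aeval a f = 0) → ∃ b : F, aeval b f = 0)
    {n : ℕ} (x : Fin n → E) :
    ∃ y : Fin n → F, ∀ f : MvPolynomial (Fin n) K,
      MvPolynomial.aeval x f = 0 → MvPolynomial.aeval y f = 0 := by
  have hred (L : Type u) [Field L] [Algebra K L] : IsReduced (L ⊗[K] E) :=
    have := hE L
    isReduced_of_injective _ (Algebra.TensorProduct.comm K L E).injective
  let k := algebraicClosure K E
  have hsep : Algebra.IsSeparable K k := ⟨fun a ↦ by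
    have := hred (AlgebraicClosure K)
    have := isSeparable_of_isReduced_tensorProduct (AlgebraicClosure K)
      (mem_algebraicClosure_iff'.mp a.2)
    rwa [IsSeparable, ← minpoly.algebraMap_eq (algebraMap k E).injective a]⟩
  obtain ⟨j⟩ : Nonempty (k →ₐ[K] F) := Field.nonempty_algHom_of_exists_root fun a ↦
    hroot _ ⟨a, by rw [Subalgebra.aeval_coe, minpoly.aeval]; rfl⟩
  let _ : Algebra k F := j.toRingHom.toAlgebra
  have : IsScalarTower K k F := .of_algebraMap_eq fun a ↦ (j.commutes a).symm
  have := hred (AlgebraicClosure F)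
  have : IsReduced (AlgebraicClosure F ⊗[k] E) :=
    isReduced_tensorProduct_of_isSeparable (K := K)
  obtain ⟨y, hy⟩ := hF.exists_specialization_of_forall_isIntegral (k := k) (fun a ha ↦
    ⟨⟨a, mem_algebraicClosure_iff'.mpr (isIntegral_trans a ha)⟩, rfl⟩) x
  refine ⟨y, fun f hf ↦ ?_⟩
  have := hy (MvPolynomial.map (algebraMap K k) f)
  rw [MvPolynomial.aeval_map_algebraMap, MvPolynomial.aeval_map_algebraMap] at this
  exact this hf

theorem IsPAC.exists_specialization_ne_zero {K E F : Type u} [Field K] [Field E] [Field F]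
    [Algebra K E] [Algebra K F] (hF : IsPAC F) (hE : IsSeparableFieldExtension K E)
    (hroot : ∀ f : Polynomial K, (∃ a : E, aeval a f = 0) → ∃ b : F, aeval b f = 0)
    {n : ℕ} (x : Fin n → E) {h : MvPolynomial (Fin n) K} (hx : MvPolynomial.aeval x h ≠ 0) :
    ∃ y : Fin n → F, (∀ f : MvPolynomial (Fin n) K,
      MvPolynomial.aeval x f = 0 → MvPolynomial.aeval y f = 0) ∧ MvPolynomial.aeval y h ≠ 0 := by
  obtain ⟨y, hy⟩ := hF.exists_specialization hE hroot
    (Fin.snoc x (MvPolynomial.aeval x h)⁻¹ : Fin (n + 1) → E)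
  refine ⟨fun i ↦ y i.castSucc, fun f hf ↦ ?_, fun h0 ↦ ?_⟩
  · have := hy (MvPolynomial.rename Fin.castSucc f)
    simp only [MvPolynomial.aeval_rename] at this
    exact this (by simpa [Function.comp_def] using hf)
  · have := hy (MvPolynomial.rename Fin.castSucc h * .X (Fin.last n) - 1) (by
      simp [MvPolynomial.aeval_rename, Function.comp_def, hx])
    simp [MvPolynomial.aeval_rename, Function.comp_def, h0] at this

end

theorem exists_mvPolynomial_forall_realize_eq_aeval {K : Type*} [Field K] {α σ : Type*} (a : α → K)
    (t : Language.ring.Term (α ⊕ σ)) :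
    ∃ p : MvPolynomial σ K, ∀ (R : Type u) [Field R] [Algebra K R] [CompatibleRing R] (y : σ → R),
      t.realize (Sum.elim (fun i ↦ algebraMap K R (a i)) y) = MvPolynomial.aeval y p := by
  induction t with
  | var i =>
    cases i with
    | inl i => exact ⟨.C (a i), fun R _ _ _ y ↦ by simp⟩
    | inr i => exact ⟨.X i, fun R _ _ _ y ↦ by simp⟩
  | func f ts ih =>
    choose p hp using ih
    cases f with
    | add => exact ⟨p 0 + p 1, fun R _ _ _ y ↦
        (CompatibleRing.funMap_add _).trans (by simp [hp])⟩
    | mul => exact ⟨p 0 * p 1, fun R _ _ _ y ↦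
        (CompatibleRing.funMap_mul _).trans (by simp [hp])⟩
    | neg => exact ⟨-p 0, fun R _ _ _ y ↦
        (CompatibleRing.funMap_neg _).trans (by simp [hp])⟩
    | zero => exact ⟨0, fun R _ _ _ y ↦
        (CompatibleRing.funMap_zero _).trans (by simp)⟩
    | one => exact ⟨1, fun R _ _ _ y ↦
        (CompatibleRing.funMap_one _).trans (by simp)⟩

/-- The truth value of a quantifier-free formula at `x` is preserved by specializations of `x`
along which a suitable polynomial does not vanish. -/
theorem exists_mvPolynomial_forall_realize_iff {K E : Type u} [Field K] [Field E] [Algebra K E]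
    [CompatibleRing E] {α : Type*} {n : ℕ} (a : α → K) (x : Fin n → E)
    {ψ : Language.ring.BoundedFormula α n} (hψ : ψ.IsQF) :
    ∃ h : MvPolynomial (Fin n) K, MvPolynomial.aeval x h ≠ 0 ∧
      ∀ (F : Type u) [Field F] [Algebra K F] [CompatibleRing F] (y : Fin n → F),
        (∀ f : MvPolynomial (Fin n) K, MvPolynomial.aeval x f = 0 → MvPolynomial.aeval y f = 0) →
        MvPolynomial.aeval y h ≠ 0 →
        (ψ.Realize (fun i ↦ algebraMap K E (a i)) x ↔
          ψ.Realize (fun i ↦ algebraMap K F (a i)) y) := by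
  induction hψ with
  | falsum => exact ⟨1, by simp, fun F _ _ _ y _ _ ↦ Iff.rfl⟩
  | of_isAtomic hat =>
    cases hat with
    | equal t₁ t₂ =>
      obtain ⟨p₁, hp₁⟩ := exists_mvPolynomial_forall_realize_eq_aeval.{u} a t₁
      obtain ⟨p₂, hp₂⟩ := exists_mvPolynomial_forall_realize_eq_aeval.{u} a t₂
      simp only [Language.BoundedFormula.realize_bdEqual, hp₁, hp₂]
      by_cases hx : MvPolynomial.aeval x (p₁ - p₂) = 0
      · refine ⟨1, by simp, fun F _ _ _ y hy _ ↦ iff_of_true ?_ ?_⟩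
        · simpa [sub_eq_zero] using hx
        · simpa [sub_eq_zero] using hy _ hx
      · refine ⟨p₁ - p₂, hx, fun F _ _ _ y hy hne ↦ iff_of_false ?_ ?_⟩
        · simpa [sub_eq_zero] using hx
        · simpa [sub_eq_zero] using hne
    | rel R _ => exact R.elim
  | imp _ _ ih₁ ih₂ =>
    obtain ⟨h₁, hx₁, H₁⟩ := ih₁
    obtain ⟨h₂, hx₂, H₂⟩ := ih₂
    refine ⟨h₁ * h₂, by simp [hx₁, hx₂], fun F _ _ _ y hy hne ↦ ?_⟩
    rw [map_mul] at hne
    simp only [Language.BoundedFormula.realize_imp]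
    rw [H₁ F y hy (left_ne_zero_of_mul hne), H₂ F y hy (right_ne_zero_of_mul hne)]

/-- The existential formula, in parameters `c`, saying that the polynomial with coefficients `c`
has a root. -/
theorem exists_formula_realize_iff_exists_root (m : ℕ) :
    ∃ φ ∈ existentialFormulasUpTo Language.ring (Fin m) 1,
      ∀ (R : Type u) [Field R] [CompatibleRing R] (c : Fin m → R),
        φ.Realize c ↔ ∃ b : R, ∑ i, c i * b ^ (i : ℕ) = 0 := by
  let p : FreeCommRing (Fin m ⊕ Fin 1) := ∑ i : Fin m, .of (.inl i) * .of (.inr 0) ^ (i : ℕ)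
  refine ⟨_, ⟨1, le_rfl, (termOfFreeCommRing p).bdEqual 0,
    (Language.BoundedFormula.IsAtomic.equal _ _).isQF, rfl⟩, fun R _ _ c ↦ ?_⟩
  rw [Language.BoundedFormula.realize_exs]
  simp only [Language.BoundedFormula.realize_bdEqual, realize_termOfFreeCommRing, p, map_sum,
    map_mul, map_pow, FreeCommRing.lift_of, Sum.elim_inl, Sum.elim_inr, realize_zero]
  exact ⟨fun ⟨xs, h⟩ ↦ ⟨xs 0, h⟩, fun ⟨b, h⟩ ↦ ⟨fun _ ↦ b, h⟩⟩

theorem subset_formulaFragmentClosure {L : FirstOrder.Language.{u, v}} {α : Type w}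
    (S : Set (L.Formula α)) : S ⊆ formulaFragmentClosure S :=
  subset_sInter fun _ h ↦ h.2.2.2

/-- let `E, F` be extensions of a field `K`, with `F` PAC and `E/K`
separable, viewed in the language of rings with constants from `K` (here: realization of
ring-language formulas at tuples of parameters from `K`).  If `Th_{∃₁}(E) ⊆ Th_{∃₁}(F)`
then `Th_∃(E) ⊆ Th_∃(F)`. -/
theorem statement_14 (K : Type u) (E F : Type u) [Field K] [Field E] [Field F]
    [Algebra K E] [Algebra K F] [CompatibleRing E] [CompatibleRing F]
    (hsep : IsSeparableFieldExtension K E) (hPAC : IsPAC F)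
    (h₁ : ∀ (m : ℕ) (φ : FirstOrder.Language.ring.Formula (Fin m)),
      φ ∈ formulaFragmentClosure (existentialFormulasUpTo FirstOrder.Language.ring (Fin m) 1) →
      ∀ a : Fin m → K,
        φ.Realize (fun i => algebraMap K E (a i)) → φ.Realize (fun i => algebraMap K F (a i))) :
    ∀ (m : ℕ) (φ : FirstOrder.Language.ring.Formula (Fin m)),
      φ ∈ formulaFragmentClosure (existentialFormulas FirstOrder.Language.ring (Fin m)) →
      ∀ a : Fin m → K,
        φ.Realize (fun i => algebraMap K E (a i)) → φ.Realize (fun i => algebraMap K F (a i)) := by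
  have hroot (f : Polynomial K) (hf : ∃ x : E, Polynomial.aeval x f = 0) :
      ∃ y : F, Polynomial.aeval y f = 0 := by
    obtain ⟨φ, hφ, H⟩ := exists_formula_realize_iff_exists_root.{u} (f.natDegree + 1)
    have := h₁ _ φ (subset_formulaFragmentClosure _ hφ) fun i ↦ f.coeff i
    simp only [H] at this
    have hsum (R : Type u) [Field R] [Algebra K R] (b : R) :
        ∑ i : Fin (f.natDegree + 1), algebraMap K R (f.coeff i) * b ^ (i : ℕ) =
          Polynomial.aeval b f := by
      rw [Polynomial.aeval_eq_sum_range, Finset.sum_range]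
      simp [Algebra.smul_def]
    simp only [hsum] at this
    exact this hf
  intro m φ hφ
  refine mem_sInter.mp hφ {φ | ∀ a : Fin m → K,
    φ.Realize (fun i ↦ algebraMap K E (a i)) → φ.Realize (fun i ↦ algebraMap K F (a i))}
    ⟨fun _ _ ↦ Language.Formula.realize_top.mpr trivial,
      fun _ h ↦ (Language.Formula.realize_bot.mp h).elim,
      fun φ ψ hφ hψ ↦ ⟨fun a h ↦ ?_, fun a h ↦ ?_⟩, ?_⟩
  · rw [Language.Formula.realize_inf] at h ⊢
    exact h.imp (hφ a) (hψ a)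
  · rw [Language.Formula.realize_sup] at h ⊢
    exact h.imp (hφ a) (hψ a)
  · rintro _ ⟨n, ψ, hψ, rfl⟩ a h
    rw [Language.BoundedFormula.realize_exs] at h ⊢
    obtain ⟨x, hx⟩ := h
    obtain ⟨g, hg, H⟩ := exists_mvPolynomial_forall_realize_iff a x hψ
    obtain ⟨y, hy, hgy⟩ := hPAC.exists_specialization_ne_zero hsep hroot x hg
    exact ⟨y, (H F y hy hgy).mp hx⟩

end PaperStmt
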